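/- arXiv:0810.2214 — 2 statements merged into one kernel-verified Lean document; each statement's English description precedes it below -/
import Mathlib

section
/- Let k ≥ 3 be an integer. If for every integer m with k+1 ≤ m ≤ 2k-1 there exists a k-homogeneous Latin bitrade of volume k·m, then for every integer m ≥ k there exists a k-homogeneous Latin bitrade of volume k·m. -/
/-- A partial Latin square: a finite set of (row, column, entry) triples such that
no two distinct triples agree in (row, column), in (row, entry), or in (column, entry). -/
def IsPartialLatinSquare (T : Finset (ℕ × ℕ × ℕ)) : Prop :=
  (∀ x ∈ T, ∀ y ∈ T, x.1 = y.1 → x.2.1 = y.2.1 → x = y) ∧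
  (∀ x ∈ T, ∀ y ∈ T, x.1 = y.1 → x.2.2 = y.2.2 → x = y) ∧
  (∀ x ∈ T, ∀ y ∈ T, x.2.1 = y.2.1 → x.2.2 = y.2.2 → x = y)

/-- A Latin bitrade: a pair of disjoint partial Latin squares with the same filled
cells, the same entry set in each row, and the same entry set in each column. -/
def IsLatinBitrade (T T' : Finset (ℕ × ℕ × ℕ)) : Prop :=
  IsPartialLatinSquare T ∧ IsPartialLatinSquare T' ∧
  Disjoint T T' ∧
  (∀ r c, (∃ e, (r, c, e) ∈ T) ↔ (∃ e, (r, c, e) ∈ T')) ∧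
  (∀ r e, (∃ c, (r, c, e) ∈ T) ↔ (∃ c, (r, c, e) ∈ T')) ∧
  (∀ c e, (∃ r, (r, c, e) ∈ T) ↔ (∃ r, (r, c, e) ∈ T'))

/-- A Latin bitrade is k-homogeneous if each nonempty row and column of T contains
exactly k filled cells, and each entry value occurring in T occurs exactly k times. -/
def IsHomogeneousLatinBitrade (k : ℕ) (T T' : Finset (ℕ × ℕ × ℕ)) : Prop :=
  IsLatinBitrade T T' ∧
  (∀ r, (∃ x ∈ T, x.1 = r) → (T.filter (fun x => x.1 = r)).card = k) ∧
  (∀ c, (∃ x ∈ T, x.2.1 = c) → (T.filter (fun x => x.2.1 = c)).card = k) ∧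
  (∀ e, (∃ x ∈ T, x.2.2 = e) → (T.filter (fun x => x.2.2 = e)).card = k)

/-- A Latin bitrade (T, T') is primary if every nonempty Latin bitrade (U, U') with
U ⊆ T and U' ⊆ T' satisfies U = T and U' = T'. -/
def IsPrimaryLatinBitrade (T T' : Finset (ℕ × ℕ × ℕ)) : Prop :=
  IsLatinBitrade T T' ∧
  ∀ U U' : Finset (ℕ × ℕ × ℕ), IsLatinBitrade U U' → U.Nonempty →
    U ⊆ T → U' ⊆ T' → U = T ∧ U' = T'

/-- Apply a map to all coordinates. -/
def mapT (f : ℕ → ℕ) (x : ℕ × ℕ × ℕ) : ℕ × ℕ × ℕ := (f x.1, f x.2.1, f x.2.2)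

lemma mapT_inj {f : ℕ → ℕ} (hf : Function.Injective f) : Function.Injective (mapT f) := by
  rintro ⟨a, b, c⟩ ⟨a', b', c'⟩ h
  simp only [mapT, Prod.mk.injEq] at h
  simp [hf h.1, hf h.2.1, hf h.2.2]

lemma pls_map {f : ℕ → ℕ} (hf : Function.Injective f) {T : Finset (ℕ × ℕ × ℕ)}
    (h : IsPartialLatinSquare T) : IsPartialLatinSquare (T.image (mapT f)) := by
  obtain ⟨h1, h2, h3⟩ := h
  refine ⟨?_, ?_, ?_⟩ <;>
  · intro x hx y hy e1 e2
    obtain ⟨x, hx0, rfl⟩ := Finset.mem_image.1 hx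
    obtain ⟨y, hy0, rfl⟩ := Finset.mem_image.1 hy
    have e1 := hf e1
    have e2 := hf e2
    congr 1
    first
      | exact h1 x hx0 y hy0 e1 e2
      | exact h2 x hx0 y hy0 e1 e2
      | exact h3 x hx0 y hy0 e1 e2

lemma mem_map_iff (f : ℕ → ℕ) (T : Finset (ℕ × ℕ × ℕ)) (r c e : ℕ) :
    (r, c, e) ∈ T.image (mapT f) ↔
      ∃ r' c' e', (r', c', e') ∈ T ∧ f r' = r ∧ f c' = c ∧ f e' = e := by
  simp [mapT]

lemma hom_map {k : ℕ} {f : ℕ → ℕ} (hf : Function.Injective f) {T T' : Finset (ℕ × ℕ × ℕ)}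
    (h : IsHomogeneousLatinBitrade k T T') :
    IsHomogeneousLatinBitrade k (T.image (mapT f)) (T'.image (mapT f)) := by
  obtain ⟨⟨p, p', d, hrc, hre, hce⟩, c1, c2, c3⟩ := h
  refine ⟨⟨pls_map hf p, pls_map hf p', (Finset.disjoint_image (mapT_inj hf)).2 d, ?_, ?_, ?_⟩,
    ?_, ?_, ?_⟩
  · intro r c
    simp only [mem_map_iff]
    constructor
    · rintro ⟨_, r', c', e', hm, rfl, rfl, rfl⟩
      obtain ⟨e, he⟩ := (hrc r' c').1 ⟨_, hm⟩
      exact ⟨_, _, _, _, he, rfl, rfl, rfl⟩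
    · rintro ⟨_, r', c', e', hm, rfl, rfl, rfl⟩
      obtain ⟨e, he⟩ := (hrc r' c').2 ⟨_, hm⟩
      exact ⟨_, _, _, _, he, rfl, rfl, rfl⟩
  · intro r c
    simp only [mem_map_iff]
    constructor
    · rintro ⟨_, r', c', e', hm, rfl, rfl, rfl⟩
      obtain ⟨e, he⟩ := (hre r' e').1 ⟨_, hm⟩
      exact ⟨_, _, _, _, he, rfl, rfl, rfl⟩
    · rintro ⟨_, r', c', e', hm, rfl, rfl, rfl⟩
      obtain ⟨e, he⟩ := (hre r' e').2 ⟨_, hm⟩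
      exact ⟨_, _, _, _, he, rfl, rfl, rfl⟩
  · intro r c
    simp only [mem_map_iff]
    constructor
    · rintro ⟨_, r', c', e', hm, rfl, rfl, rfl⟩
      obtain ⟨e, he⟩ := (hce c' e').1 ⟨_, hm⟩
      exact ⟨_, _, _, _, he, rfl, rfl, rfl⟩
    · rintro ⟨_, r', c', e', hm, rfl, rfl, rfl⟩
      obtain ⟨e, he⟩ := (hce c' e').2 ⟨_, hm⟩
      exact ⟨_, _, _, _, he, rfl, rfl, rfl⟩
  · rintro r ⟨x, hx, rfl⟩
    obtain ⟨x, hx0, rfl⟩ := Finset.mem_image.1 hx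
    rw [Finset.filter_image, Finset.card_image_of_injective _ (mapT_inj hf),
      ← c1 x.1 ⟨x, hx0, rfl⟩]
    simp only [mapT, hf.eq_iff]
  · rintro r ⟨x, hx, rfl⟩
    obtain ⟨x, hx0, rfl⟩ := Finset.mem_image.1 hx
    rw [Finset.filter_image, Finset.card_image_of_injective _ (mapT_inj hf),
      ← c2 x.2.1 ⟨x, hx0, rfl⟩]
    simp only [mapT, hf.eq_iff]
  · rintro r ⟨x, hx, rfl⟩
    obtain ⟨x, hx0, rfl⟩ := Finset.mem_image.1 hx
    rw [Finset.filter_image, Finset.card_image_of_injective _ (mapT_inj hf),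
      ← c3 x.2.2 ⟨x, hx0, rfl⟩]
    simp only [mapT, hf.eq_iff]

/-- All coordinates have parity `i`. -/
def Par (i : ℕ) (T : Finset (ℕ × ℕ × ℕ)) : Prop :=
  ∀ x ∈ T, x.1 % 2 = i ∧ x.2.1 % 2 = i ∧ x.2.2 % 2 = i

lemma pls_union {A B : Finset (ℕ × ℕ × ℕ)} (hA : Par 0 A) (hB : Par 1 B)
    (h : IsPartialLatinSquare A) (h' : IsPartialLatinSquare B) :
    IsPartialLatinSquare (A ∪ B) := by
  obtain ⟨h1, h2, h3⟩ := h
  obtain ⟨h1', h2', h3'⟩ := h'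
  refine ⟨?_, ?_, ?_⟩ <;>
  · intro x hx y hy e1 e2
    rcases Finset.mem_union.1 hx with hx | hx <;> rcases Finset.mem_union.1 hy with hy | hy
    · first
        | exact h1 x hx y hy e1 e2
        | exact h2 x hx y hy e1 e2
        | exact h3 x hx y hy e1 e2
    · have := hA x hx; have := hB y hy; omega
    · have := hB x hx; have := hA y hy; omega
    · first
        | exact h1' x hx y hy e1 e2
        | exact h2' x hx y hy e1 e2
        | exact h3' x hx y hy e1 e2

lemma par_disj {A B : Finset (ℕ × ℕ × ℕ)} (hA : Par 0 A) (hB : Par 1 B) : Disjoint A B := by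
  rw [Finset.disjoint_left]
  intro x hx hy
  have := hA x hx
  have := hB x hy
  omega

lemma card_union_filter {k : ℕ} {A B : Finset (ℕ × ℕ × ℕ)} (g : ℕ × ℕ × ℕ → ℕ)
    (hA : ∀ x ∈ A, g x % 2 = 0) (hB : ∀ x ∈ B, g x % 2 = 1)
    (cA : ∀ r, (∃ x ∈ A, g x = r) → (A.filter (fun x => g x = r)).card = k)
    (cB : ∀ r, (∃ x ∈ B, g x = r) → (B.filter (fun x => g x = r)).card = k) :
    ∀ r, (∃ x ∈ A ∪ B, g x = r) → ((A ∪ B).filter (fun x => g x = r)).card = k := by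
  rintro r ⟨x, hx, hr⟩
  rw [Finset.filter_union]
  rcases Finset.mem_union.1 hx with hx | hx
  · rw [(Finset.filter_eq_empty_iff (s := B)).2, Finset.union_empty]
    · exact cA r ⟨x, hx, hr⟩
    · intro y hy he
      have := hA x hx; have := hB y hy; omega
  · rw [(Finset.filter_eq_empty_iff (s := A)).2, Finset.empty_union]
    · exact cB r ⟨x, hx, hr⟩
    · intro y hy he
      have := hB x hx; have := hA y hy; omega

lemma hom_union {k : ℕ} {A A' B B' : Finset (ℕ × ℕ × ℕ)} (pA : Par 0 A) (pA' : Par 0 A')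
    (pB : Par 1 B) (pB' : Par 1 B')
    (hA : IsHomogeneousLatinBitrade k A A') (hB : IsHomogeneousLatinBitrade k B B') :
    IsHomogeneousLatinBitrade k (A ∪ B) (A' ∪ B') := by
  obtain ⟨⟨p, p', d, hrc, hre, hce⟩, c1, c2, c3⟩ := hA
  obtain ⟨⟨q, q', d', hrc', hre', hce'⟩, c1', c2', c3'⟩ := hB
  refine ⟨⟨pls_union pA pB p q, pls_union pA' pB' p' q', ?_, ?_, ?_, ?_⟩,
    card_union_filter (fun x => x.1) (fun x hx => (pA x hx).1) (fun x hx => (pB x hx).1) c1 c1',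
    card_union_filter (fun x => x.2.1) (fun x hx => (pA x hx).2.1)
      (fun x hx => (pB x hx).2.1) c2 c2',
    card_union_filter (fun x => x.2.2) (fun x hx => (pA x hx).2.2)
      (fun x hx => (pB x hx).2.2) c3 c3'⟩
  · rw [Finset.disjoint_union_left, Finset.disjoint_union_right, Finset.disjoint_union_right]
    exact ⟨⟨d, par_disj pA pB'⟩, (par_disj pA' pB).symm, d'⟩
  · intro r c
    simp only [Finset.mem_union, exists_or, hrc, hrc']
  · intro r c
    simp only [Finset.mem_union, exists_or, hre, hre']
  · intro r c
    simp only [Finset.mem_union, exists_or, hce, hce']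

/-- Shifted cyclic Latin square. -/
def cyc (k : ℕ) [NeZero k] (s : ZMod k) : Finset (ℕ × ℕ × ℕ) :=
  (Finset.univ : Finset (ZMod k × ZMod k)).image
    (fun p => (p.1.val, p.2.val, (p.1 + p.2 + s).val))

lemma mem_cyc {k : ℕ} [NeZero k] {s : ZMod k} {x : ℕ × ℕ × ℕ} :
    x ∈ cyc k s ↔ ∃ a b : ZMod k, (a.val, b.val, (a + b + s).val) = x := by
  simp [cyc]

lemma cyc_pls (k : ℕ) [NeZero k] (s : ZMod k) : IsPartialLatinSquare (cyc k s) := by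
  have hv := ZMod.val_injective k
  refine ⟨?_, ?_, ?_⟩ <;>
  · intro x hx y hy e1 e2
    obtain ⟨a, b, rfl⟩ := mem_cyc.1 hx
    obtain ⟨a', b', rfl⟩ := mem_cyc.1 hy
    have e1 := hv e1
    have e2 := hv e2
    simp_all

lemma cyc_card_aux (k : ℕ) [NeZero k] (F : ZMod k → ℕ × ℕ × ℕ) (hF : Function.Injective F)
    (S : Finset (ℕ × ℕ × ℕ)) (h : ∀ x, x ∈ S ↔ ∃ a, F a = x) : S.card = k := by
  have : S = Finset.univ.image F := by
    ext x; simp [h]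
  rw [this, Finset.card_image_of_injective _ hF, Finset.card_univ, ZMod.card]

lemma cyc_hom (k : ℕ) [NeZero k] (hk : 2 ≤ k) :
    IsHomogeneousLatinBitrade k (cyc k 0) (cyc k 1) := by
  have hv := ZMod.val_injective k
  haveI : Fact (1 < k) := ⟨hk⟩
  refine ⟨⟨cyc_pls k 0, cyc_pls k 1, ?_, ?_, ?_, ?_⟩, ?_, ?_, ?_⟩
  · rw [Finset.disjoint_left]
    intro x hx hy
    obtain ⟨a, b, rfl⟩ := mem_cyc.1 hx
    obtain ⟨a', b', h⟩ := mem_cyc.1 hy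
    simp only [Prod.mk.injEq, hv.eq_iff] at h
    obtain ⟨rfl, rfl, h⟩ := h
    simp at h
  · intro r c
    simp only [mem_cyc, Prod.mk.injEq]
    constructor
    · rintro ⟨e, a, b, rfl, rfl, rfl⟩
      exact ⟨_, a, b, rfl, rfl, rfl⟩
    · rintro ⟨e, a, b, rfl, rfl, rfl⟩
      exact ⟨_, a, b, rfl, rfl, rfl⟩
  · intro r c
    simp only [mem_cyc, Prod.mk.injEq]
    constructor
    · rintro ⟨e, a, b, rfl, rfl, rfl⟩
      exact ⟨_, a, b - 1, rfl, rfl, by congr 1; ring⟩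
    · rintro ⟨e, a, b, rfl, rfl, rfl⟩
      exact ⟨_, a, b + 1, rfl, rfl, by congr 1; ring⟩
  · intro r c
    simp only [mem_cyc, Prod.mk.injEq]
    constructor
    · rintro ⟨e, a, b, rfl, rfl, rfl⟩
      exact ⟨_, a - 1, b, rfl, rfl, by congr 1; ring⟩
    · rintro ⟨e, a, b, rfl, rfl, rfl⟩
      exact ⟨_, a + 1, b, rfl, rfl, by congr 1; ring⟩
  · rintro r ⟨x, hx, rfl⟩
    obtain ⟨a, b, rfl⟩ := mem_cyc.1 hx
    apply cyc_card_aux k (fun b => (a.val, b.val, (a + b + 0).val))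
    · intro b b' h
      simp only [Prod.mk.injEq, hv.eq_iff] at h
      exact h.2.1
    · intro x
      simp only [Finset.mem_filter, mem_cyc]
      constructor
      · rintro ⟨⟨a', b', rfl⟩, h⟩
        have := hv h
        subst this
        exact ⟨b', rfl⟩
      · rintro ⟨b', rfl⟩
        exact ⟨⟨a, b', rfl⟩, rfl⟩
  · rintro r ⟨x, hx, rfl⟩
    obtain ⟨a, b, rfl⟩ := mem_cyc.1 hx
    apply cyc_card_aux k (fun a => (a.val, b.val, (a + b + 0).val))
    · intro b b' h
      simp only [Prod.mk.injEq, hv.eq_iff] at h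
      exact h.1
    · intro x
      simp only [Finset.mem_filter, mem_cyc]
      constructor
      · rintro ⟨⟨a', b', rfl⟩, h⟩
        have := hv h
        subst this
        exact ⟨a', rfl⟩
      · rintro ⟨b', rfl⟩
        exact ⟨⟨b', b, rfl⟩, rfl⟩
  · rintro r ⟨x, hx, rfl⟩
    obtain ⟨a, b, rfl⟩ := mem_cyc.1 hx
    apply cyc_card_aux k (fun t => (t.val, (a + b - t).val, (a + b + 0).val))
    · intro b b' h
      simp only [Prod.mk.injEq, hv.eq_iff] at h
      exact h.1
    · intro x
      simp only [Finset.mem_filter, mem_cyc]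
      constructor
      · rintro ⟨⟨a', b', rfl⟩, h⟩
        have h : a' + b' + 0 = a + b + 0 := hv h
        simp only [add_zero] at h
        refine ⟨a', ?_⟩
        simp [← h]
      · rintro ⟨b', rfl⟩
        exact ⟨⟨b', a + b - b', by simp⟩, rfl⟩

lemma cyc_card (k : ℕ) [NeZero k] (s : ZMod k) : (cyc k s).card = k * k := by
  have hv := ZMod.val_injective k
  rw [cyc, Finset.card_image_of_injective, Finset.card_univ, Fintype.card_prod, ZMod.card]
  rintro ⟨a, b⟩ ⟨a', b'⟩ h
  simp only [Prod.mk.injEq, hv.eq_iff] at h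
  simp [h.1, h.2.1]

theorem stmt_17 (k : ℕ) (hk : 3 ≤ k)
    (h : ∀ m : ℕ, k + 1 ≤ m → m ≤ 2 * k - 1 →
      ∃ T T' : Finset (ℕ × ℕ × ℕ),
        IsHomogeneousLatinBitrade k T T' ∧ T.card = k * m) :
    ∀ m : ℕ, k ≤ m →
      ∃ T T' : Finset (ℕ × ℕ × ℕ),
        IsHomogeneousLatinBitrade k T T' ∧ T.card = k * m := by
  haveI : NeZero k := ⟨by omega⟩
  intro m
  induction m using Nat.strong_induction_on with
  | _ m ih =>
    intro hm
    rcases hm.eq_or_lt with rfl | hlt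
    · exact ⟨_, _, cyc_hom k (by omega), cyc_card k 0⟩
    by_cases h2 : m ≤ 2 * k - 1
    · exact h m hlt h2
    obtain ⟨T, T', hT, cT⟩ := ih (m - k) (by omega) (by omega)
    have i0 : Function.Injective (fun n : ℕ => 2 * n) := fun a b h => by
      simp only at h; omega
    have i1 : Function.Injective (fun n : ℕ => 2 * n + 1) := fun a b h => by
      simp only at h; omega
    have p0 : ∀ S : Finset (ℕ × ℕ × ℕ), Par 0 (S.image (mapT (fun n : ℕ => 2 * n))) := by
      intro S x hx
      obtain ⟨x, -, rfl⟩ := Finset.mem_image.1 hx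
      simp only [mapT]; omega
    have p1 : ∀ S : Finset (ℕ × ℕ × ℕ), Par 1 (S.image (mapT (fun n : ℕ => 2 * n + 1))) := by
      intro S x hx
      obtain ⟨x, -, rfl⟩ := Finset.mem_image.1 hx
      simp only [mapT]; omega
    refine ⟨_, _, hom_union (p0 _) (p0 _) (p1 _) (p1 _) (hom_map i0 hT)
      (hom_map i1 (cyc_hom k (by omega))), ?_⟩
    rw [Finset.card_union_of_disjoint (par_disj (p0 _) (p1 _)),
      Finset.card_image_of_injective _ (mapT_inj i0),
      Finset.card_image_of_injective _ (mapT_inj i1), cT, cyc_card, ← mul_add]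
    congr 1
    omega
end

section
/- For every integer k with 5 ≤ k ≤ 8 and every integer m with m ≥ k, there exists a k-homogeneous Latin bitrade of volume k·m. -/
/-- Bitrades from an abstract parametrisation of the cells. -/
theorem core_bitrade {P G : Type} [Fintype P] [DecidableEq P] [Fintype G] [DecidableEq G]
    (k m : ℕ) (r c e f : P → G)
    (h1 : ∀ p q, r p = r q → c p = c q → p = q)
    (h2 : ∀ p q, r p = r q → e p = e q → p = q)
    (h3 : ∀ p q, c p = c q → e p = e q → p = q)
    (h4 : ∀ p q, r p = r q → f p = f q → p = q)
    (h5 : ∀ p q, c p = c q → f p = f q → p = q)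
    (hne : ∀ p, e p ≠ f p)
    (hr1 : ∀ p, ∃ q, r q = r p ∧ f q = e p)
    (hr2 : ∀ p, ∃ q, r q = r p ∧ e q = f p)
    (hc1 : ∀ p, ∃ q, c q = c p ∧ f q = e p)
    (hc2 : ∀ p, ∃ q, c q = c p ∧ e q = f p)
    (kr : ∀ y, (Finset.univ.filter (fun q => r q = y)).card = k)
    (kc : ∀ y, (Finset.univ.filter (fun q => c q = y)).card = k)
    (ke : ∀ y, (Finset.univ.filter (fun q => e q = y)).card = k)
    (hP : Fintype.card P = k * m) :
    ∃ T T' : Finset (ℕ × ℕ × ℕ),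
      IsHomogeneousLatinBitrade k T T' ∧ T.card = k * m := by
  obtain ⟨φ, hφ⟩ : ∃ φ : G → ℕ, Function.Injective φ :=
    ⟨fun g => (Fintype.equivFin G g).val, fun a b h =>
      (Fintype.equivFin G).injective (Fin.ext h)⟩
  have hi : ∀ a b, φ a = φ b ↔ a = b := fun a b => hφ.eq_iff
  have inj : Function.Injective (fun p => (φ (r p), φ (c p), φ (e p))) := by
    intro p q h
    simp only [Prod.mk.injEq, hi] at h
    exact h1 p q h.1 h.2.1
  refine ⟨Finset.univ.image (fun p => (φ (r p), φ (c p), φ (e p))),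
    Finset.univ.image (fun p => (φ (r p), φ (c p), φ (f p))), ⟨⟨?_, ?_, ?_, ?_, ?_, ?_⟩, ?_, ?_, ?_⟩, ?_⟩
  · refine ⟨?_, ?_, ?_⟩ <;> simp only [Finset.mem_image, Finset.mem_univ, true_and] <;>
      rintro _ ⟨p, rfl⟩ _ ⟨q, rfl⟩ ha hb <;> simp only [hi] at ha hb
    · rw [h1 p q ha hb]
    · rw [h2 p q ha hb]
    · rw [h3 p q ha hb]
  · refine ⟨?_, ?_, ?_⟩ <;> simp only [Finset.mem_image, Finset.mem_univ, true_and] <;>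
      rintro _ ⟨p, rfl⟩ _ ⟨q, rfl⟩ ha hb <;> simp only [hi] at ha hb
    · rw [h1 p q ha hb]
    · rw [h4 p q ha hb]
    · rw [h5 p q ha hb]
  · rw [Finset.disjoint_left]
    simp only [Finset.mem_image, Finset.mem_univ, true_and]
    rintro _ ⟨p, rfl⟩ ⟨q, hq⟩
    simp only [Prod.mk.injEq, hi] at hq
    have := h1 q p hq.1 hq.2.1
    subst this
    exact hne q hq.2.2.symm
  · intro x y
    simp only [Finset.mem_image, Finset.mem_univ, true_and, Prod.mk.injEq]
    constructor
    · rintro ⟨_, p, a, b, _⟩; exact ⟨_, p, a, b, rfl⟩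
    · rintro ⟨_, p, a, b, _⟩; exact ⟨_, p, a, b, rfl⟩
  · intro x y
    simp only [Finset.mem_image, Finset.mem_univ, true_and, Prod.mk.injEq]
    constructor
    · rintro ⟨_, p, rfl, _, rfl⟩
      obtain ⟨q, a, b⟩ := hr1 p
      exact ⟨_, q, by rw [a], rfl, by rw [b]⟩
    · rintro ⟨_, p, rfl, _, rfl⟩
      obtain ⟨q, a, b⟩ := hr2 p
      exact ⟨_, q, by rw [a], rfl, by rw [b]⟩
  · intro x y
    simp only [Finset.mem_image, Finset.mem_univ, true_and, Prod.mk.injEq]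
    constructor
    · rintro ⟨_, p, _, rfl, rfl⟩
      obtain ⟨q, a, b⟩ := hc1 p
      exact ⟨_, q, rfl, by rw [a], by rw [b]⟩
    · rintro ⟨_, p, _, rfl, rfl⟩
      obtain ⟨q, a, b⟩ := hc2 p
      exact ⟨_, q, rfl, by rw [a], by rw [b]⟩
  · rintro x ⟨t, ht, rfl⟩
    simp only [Finset.mem_image, Finset.mem_univ, true_and] at ht
    obtain ⟨p, rfl⟩ := ht
    rw [Finset.filter_image, Finset.card_image_of_injective _ inj]
    simpa only [hi] using kr (r p)
  · rintro x ⟨t, ht, rfl⟩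
    simp only [Finset.mem_image, Finset.mem_univ, true_and] at ht
    obtain ⟨p, rfl⟩ := ht
    rw [Finset.filter_image, Finset.card_image_of_injective _ inj]
    simpa only [hi] using kc (c p)
  · rintro x ⟨t, ht, rfl⟩
    simp only [Finset.mem_image, Finset.mem_univ, true_and] at ht
    obtain ⟨p, rfl⟩ := ht
    rw [Finset.filter_image, Finset.card_image_of_injective _ inj]
    simpa only [hi] using ke (e p)
  · rw [Finset.card_image_of_injective _ inj, Finset.card_univ, hP]

/-- Counting a translated family. -/
theorem card_translate {G : Type} [AddCommGroup G] [Fintype G] [DecidableEq G] {k : ℕ}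
    (a : Fin k → G) (y : G) :
    (Finset.univ.filter (fun q : G × Fin k => q.1 + a q.2 = y)).card = k := by
  have : Finset.univ.filter (fun q : G × Fin k => q.1 + a q.2 = y)
      = Finset.univ.image (fun j : Fin k => (y - a j, j)) := by
    ext ⟨i, j⟩
    simp only [Finset.mem_filter, Finset.mem_univ, true_and, Finset.mem_image, Prod.mk.injEq]
    constructor
    · rintro rfl; exact ⟨j, by simp, rfl⟩
    · rintro ⟨j, rfl, rfl⟩; simp
  rw [this, Finset.card_image_of_injective, Finset.card_univ, Fintype.card_fin]
  intro i j h
  exact (Prod.mk.inj h).2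

/-- Bitrades developed cyclically from a base row. -/
theorem cyclic_bitrade {G : Type} [AddCommGroup G] [Fintype G] [DecidableEq G]
    (k m : ℕ) (hG : Fintype.card G = m) (a b d : Fin k → G)
    (ha : ∀ i j, a i = a j → i = j)
    (hb : ∀ i j, b i = b j → i = j)
    (hd : ∀ i j, d i = d j → i = j)
    (hba : ∀ i j, b i - a i = b j - a j → i = j)
    (hda : ∀ i j, d i - a i = d j - a j → i = j)
    (hne : ∀ i, b i ≠ d i)
    (hr1 : ∀ i, ∃ j, d j = b i)
    (hr2 : ∀ i, ∃ j, b j = d i)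
    (hc1 : ∀ i, ∃ j, d j - a j = b i - a i)
    (hc2 : ∀ i, ∃ j, b j - a j = d i - a i) :
    ∃ T T' : Finset (ℕ × ℕ × ℕ),
      IsHomogeneousLatinBitrade k T T' ∧ T.card = k * m := by
  refine core_bitrade (P := G × Fin k) (G := G) k m (fun p => p.1) (fun p => p.1 + a p.2)
    (fun p => p.1 + b p.2) (fun p => p.1 + d p.2) ?_ ?_ ?_ ?_ ?_ ?_ ?_ ?_ ?_ ?_ ?_ ?_ ?_ ?_
  · rintro ⟨i, j⟩ ⟨i', j'⟩ h h'
    simp only at h h'; subst h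
    rw [ha j j' (add_left_cancel h')]
  · rintro ⟨i, j⟩ ⟨i', j'⟩ h h'
    simp only at h h'; subst h
    rw [hb j j' (add_left_cancel h')]
  · rintro ⟨i, j⟩ ⟨i', j'⟩ h h'
    simp only at h h'
    have : j = j' := hba j j' (by
      have : (i + b j) - (i + a j) = (i' + b j') - (i' + a j') := by rw [h, h']
      simpa using this)
    subst this
    rw [add_right_cancel h]
  · rintro ⟨i, j⟩ ⟨i', j'⟩ h h'
    simp only at h h'; subst h
    rw [hd j j' (add_left_cancel h')]
  · rintro ⟨i, j⟩ ⟨i', j'⟩ h h'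
    simp only at h h'
    have : j = j' := hda j j' (by
      have : (i + d j) - (i + a j) = (i' + d j') - (i' + a j') := by rw [h, h']
      simpa using this)
    subst this
    rw [add_right_cancel h]
  · rintro ⟨i, j⟩ h
    exact hne j (add_left_cancel h)
  · rintro ⟨i, j⟩
    obtain ⟨j', h⟩ := hr1 j
    exact ⟨(i, j'), rfl, by simp only [h]⟩
  · rintro ⟨i, j⟩
    obtain ⟨j', h⟩ := hr2 j
    exact ⟨(i, j'), rfl, by simp only [h]⟩
  · rintro ⟨i, j⟩
    obtain ⟨j', h⟩ := hc1 j
    refine ⟨(i + a j - a j', j'), by simp, ?_⟩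
    have : i + a j - a j' + d j' = i + a j + (d j' - a j') := by abel
    simp only [this, h]; abel
  · rintro ⟨i, j⟩
    obtain ⟨j', h⟩ := hc2 j
    refine ⟨(i + a j - a j', j'), by simp, ?_⟩
    have : i + a j - a j' + b j' = i + a j + (b j' - a j') := by abel
    simp only [this, h]; abel
  · intro y
    simpa using card_translate (fun _ : Fin k => (0 : G)) y
  · exact card_translate a
  · exact card_translate b
  · rw [Fintype.card_prod, hG, Fintype.card_fin, mul_comm]

/-- Base rows over the integers, reduced modulo `m`. -/
theorem int_bitrade (k m s w : ℕ) (hm : w ≤ m) (hm0 : 0 < m) (a b d : Fin k → ℕ)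
    (haw : ∀ i, a i < w) (hbw : ∀ i, b i < w) (hdw : ∀ i, d i < w)
    (hbas : ∀ i, a i ≤ b i + s ∧ b i + s - a i < w)
    (hdas : ∀ i, a i ≤ d i + s ∧ d i + s - a i < w)
    (ha : ∀ i j, a i = a j → i = j)
    (hb : ∀ i j, b i = b j → i = j)
    (hd : ∀ i j, d i = d j → i = j)
    (hba : ∀ i j, b i + s - a i = b j + s - a j → i = j)
    (hda : ∀ i j, d i + s - a i = d j + s - a j → i = j)
    (hne : ∀ i, b i ≠ d i)
    (hr1 : ∀ i, ∃ j, d j = b i)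
    (hr2 : ∀ i, ∃ j, b j = d i)
    (hc1 : ∀ i, ∃ j, d j + s - a j = b i + s - a i)
    (hc2 : ∀ i, ∃ j, b j + s - a j = d i + s - a i) :
    ∃ T T' : Finset (ℕ × ℕ × ℕ),
      IsHomogeneousLatinBitrade k T T' ∧ T.card = k * m := by
  have : NeZero m := ⟨hm0.ne'⟩
  have key : ∀ x y : ℕ, x < w → y < w → (x : ZMod m) = (y : ZMod m) → x = y := by
    intro x y hx hy h
    rw [ZMod.natCast_eq_natCast_iff] at h
    exact Nat.ModEq.eq_of_lt_of_lt h (by omega) (by omega)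
  have eb : ∀ i, ((b i : ZMod m) - (a i : ZMod m)) = ((b i + s - a i : ℕ) : ZMod m) - (s : ZMod m) := by
    intro i
    rw [Nat.cast_sub (hbas i).1]; push_cast; ring
  have ed : ∀ i, ((d i : ZMod m) - (a i : ZMod m)) = ((d i + s - a i : ℕ) : ZMod m) - (s : ZMod m) := by
    intro i
    rw [Nat.cast_sub (hdas i).1]; push_cast; ring
  refine cyclic_bitrade (G := ZMod m) k m (ZMod.card m) (fun i => (a i : ZMod m))
    (fun i => (b i : ZMod m)) (fun i => (d i : ZMod m)) ?_ ?_ ?_ ?_ ?_ ?_ ?_ ?_ ?_ ?_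
  · intro i j h; exact ha i j (key _ _ (haw i) (haw j) h)
  · intro i j h; exact hb i j (key _ _ (hbw i) (hbw j) h)
  · intro i j h; exact hd i j (key _ _ (hdw i) (hdw j) h)
  · intro i j h
    simp only [eb] at h
    exact hba i j (key _ _ (hbas i).2 (hbas j).2 (sub_left_injective h))
  · intro i j h
    simp only [ed] at h
    exact hda i j (key _ _ (hdas i).2 (hdas j).2 (sub_left_injective h))
  · intro i h; exact hne i (key _ _ (hbw i) (hdw i) h)
  · intro i; obtain ⟨j, h⟩ := hr1 i; exact ⟨j, by simp only [h]⟩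
  · intro i; obtain ⟨j, h⟩ := hr2 i; exact ⟨j, by simp only [h]⟩
  · intro i; obtain ⟨j, h⟩ := hc1 i; exact ⟨j, by simp only [eb, ed, h]⟩
  · intro i; obtain ⟨j, h⟩ := hc2 i; exact ⟨j, by simp only [eb, ed, h]⟩

/-- Two disjoint Latin squares of order `k`. -/
theorem square_bitrade (k : ℕ) (hk : 2 ≤ k) :
    ∃ T T' : Finset (ℕ × ℕ × ℕ),
      IsHomogeneousLatinBitrade k T T' ∧ T.card = k * k := by
  have : NeZero k := ⟨by omega⟩
  have : Fact (1 < k) := ⟨by omega⟩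
  have cnt : ∀ (g : ZMod k → ZMod k → ZMod k), (∀ j y, ∃! i, g i j = y) → ∀ y,
      (Finset.univ.filter (fun q : ZMod k × ZMod k => g q.1 q.2 = y)).card = k := by
    intro g hg y
    choose u hu hu' using fun j => hg j y
    have : Finset.univ.filter (fun q : ZMod k × ZMod k => g q.1 q.2 = y)
        = Finset.univ.image (fun j => (u j, j)) := by
      ext ⟨i, j⟩
      simp only [Finset.mem_filter, Finset.mem_univ, true_and, Finset.mem_image, Prod.mk.injEq]
      constructor
      · intro h; exact ⟨j, (hu' j i h).symm, rfl⟩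
      · rintro ⟨j, rfl, rfl⟩; exact hu j
    rw [this, Finset.card_image_of_injective, Finset.card_univ, ZMod.card]
    intro i j h
    exact (Prod.mk.inj h).2
  refine core_bitrade (P := ZMod k × ZMod k) (G := ZMod k) k k (fun p => p.1) (fun p => p.2)
    (fun p => p.1 + p.2) (fun p => p.1 + p.2 + 1) ?_ ?_ ?_ ?_ ?_ ?_ ?_ ?_ ?_ ?_ ?_ ?_ ?_ ?_
  · rintro ⟨i, j⟩ ⟨i', j'⟩ h h'
    simp_all
  · rintro ⟨i, j⟩ ⟨i', j'⟩ h h'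
    simp_all
  · rintro ⟨i, j⟩ ⟨i', j'⟩ h h'
    simp_all
  · rintro ⟨i, j⟩ ⟨i', j'⟩ h h'
    simp_all
  · rintro ⟨i, j⟩ ⟨i', j'⟩ h h'
    simp_all
  · rintro ⟨i, j⟩
    simp
  · rintro ⟨i, j⟩
    exact ⟨(i, j - 1), rfl, by ring⟩
  · rintro ⟨i, j⟩
    exact ⟨(i, j + 1), rfl, by ring⟩
  · rintro ⟨i, j⟩
    exact ⟨(i - 1, j), rfl, by ring⟩
  · rintro ⟨i, j⟩
    exact ⟨(i + 1, j), rfl, by ring⟩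
  · exact cnt (fun i _ => i) (fun j y => ⟨y, rfl, fun _ h => h⟩)
  · intro y
    refine Eq.trans ?_ (cnt (fun i _ => i) (fun j y => ⟨y, rfl, fun _ h => h⟩) y)
    exact Finset.card_equiv (Equiv.prodComm _ _) (by simp)
  · exact cnt (fun i j => i + j) (fun j y => ⟨y - j, by simp, fun x h => by
      simp only at h; rw [← h]; ring⟩)
  · rw [Fintype.card_prod, ZMod.card]

theorem stmt_18 (k m : ℕ) (hk5 : 5 ≤ k) (hk8 : k ≤ 8) (hm : k ≤ m) :
    ∃ T T' : Finset (ℕ × ℕ × ℕ),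
      IsHomogeneousLatinBitrade k T T' ∧ T.card = k * m := by
  obtain rfl | hlt := Nat.eq_or_lt_of_le hm
  · exact square_bitrade k (by omega)
  obtain rfl | rfl | rfl | rfl : k = 5 ∨ k = 6 ∨ k = 7 ∨ k = 8 := by omega
  · apply int_bitrade 5 m 2 5 hm (by omega) ![0, 1, 2, 3, 4] ![1, 3, 0, 2, 4] ![0, 2, 4, 1, 3] <;>
      decide
  · obtain rfl | h8 := Nat.eq_or_lt_of_le hlt
    · apply cyclic_bitrade (G := ZMod 7) 6 7 (ZMod.card 7) ![0, 1, 2, 3, 4, 5]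
        ![2, 0, 5, 4, 1, 3] ![1, 4, 0, 5, 3, 2] <;> decide
    · apply int_bitrade 6 m 4 8 h8 (by omega) ![0, 1, 2, 3, 4, 5]
        ![1, 4, 2, 5, 0, 3] ![0, 3, 5, 4, 2, 1] <;> decide
  · apply int_bitrade 7 m 3 7 hm (by omega) ![0, 1, 2, 3, 4, 5, 6]
      ![1, 0, 4, 6, 2, 5, 3] ![0, 3, 5, 2, 1, 6, 4] <;> decide
  · obtain rfl | h8 := Nat.eq_or_lt_of_le hlt
    · apply cyclic_bitrade (G := ZMod 9) 8 9 (ZMod.card 9) ![0, 1, 2, 3, 4, 5, 6, 7]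
        ![2, 0, 5, 7, 1, 6, 4, 3] ![1, 3, 6, 0, 7, 4, 2, 5] <;> decide
    · apply int_bitrade 8 m 5 10 h8 (by omega) ![0, 1, 2, 3, 4, 5, 6, 7]
        ![1, 3, 5, 7, 0, 4, 6, 2] ![0, 4, 6, 2, 5, 7, 1, 3] <;> decide
end
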